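/- arXiv:1507.08923 — 2 statements merged into one kernel-verified Lean document; each statement's English description precedes it below -/
import Mathlib

section
/- Let $a$ be an even positive integer. Define for each $n \ge 1$ the quantity $S(n) = \sum_{j=0}^{a} \sum_{i=1}^{n} \frac{1}{n^{a}} \binom{a}{j} (-1)^{j} n^{j} \frac{(i - \tfrac{1}{2})^{a-j} \cdot i^{\overline{j}}}{(n+1)^{\overline{j}}}$, where $m^{\overline{j}} = m(m+1)\cdots(m+j-1)$ denotes the rising factorial (with $m^{\overline{0}} = 1$). Then $S(n) = \frac{(a/2)!}{2^{a/2}(1+a)} \cdot \frac{1}{n^{a/2-1}} + O\left(\frac{1}{n^{a/2}}\right)$; that is, there exist a constant $C > 0$ and $N$ such that for all $n \ge N$, $\left| S(n) - \frac{(a/2)!}{2^{a/2}(1+a)} n^{1 - a/2} \right| \le C \, n^{-a/2}$. -/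
/-- The rising factorial `m^{\overline{j}} = m (m+1) ⋯ (m+j-1)`, with `rise m 0 = 1`. -/
def rise (m : ℝ) (j : ℕ) : ℝ := ∏ k ∈ Finset.range j, (m + k)

open Finset Polynomial

/-- Binomial moments. -/
def momU {R : Type*} [CommRing R] (x h : R) (m r : ℕ) : R :=
  ∑ v ∈ range (m + 1), (m.choose v : R) * (x ^ v * (1 - x) ^ (m - v) * ((v : R) + h - (m + 1) * x) ^ r)

/-- Moments of a centred Bernoulli variable. -/
def bE {R : Type*} [CommRing R] (x : R) (j : ℕ) : R := x * (1 - x) ^ j + (1 - x) * (-x) ^ j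

/-- Coefficients in the binomial basis. -/
def cC {R : Type*} [CommRing R] (x h : R) : ℕ → ℕ → R
  | 0, r => (h - x) ^ r
  | l + 1, r => ∑ s ∈ range r, (r.choose s : R) * cC x h l s * bE x (r - s)

theorem momU_succ {R : Type*} [CommRing R] (x h : R) (m r : ℕ) :
    momU x h (m + 1) r = momU x h m r + ∑ s ∈ range r, (r.choose s : R) * momU x h m s * bE x (r - s) := by
  have h1 : momU x h (m + 1) r = ∑ v ∈ range (m + 1), (m.choose v : R) * (x ^ v * (1 - x) ^ (m - v)) *
      (∑ s ∈ range (r + 1), (r.choose s : R) * ((v : R) + h - (m + 1) * x) ^ s * bE x (r - s)) := by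
    unfold momU
    rw [Finset.sum_choose_succ_mul (fun i j => x ^ i * (1 - x) ^ j * ((i : R) + h - (((m + 1 : ℕ) : R) + 1) * x) ^ r),
      ← Finset.sum_add_distrib]
    refine Finset.sum_congr rfl fun v hv => ?_
    have hv' : v ≤ m := by simp at hv; omega
    have e1 : ((v : R) + h - (((m + 1 : ℕ) : R) + 1) * x) = ((v : R) + h - (m + 1) * x) + (-x) := by
      push_cast; ring
    have e2 : (((v + 1 : ℕ) : R) + h - (((m + 1 : ℕ) : R) + 1) * x) = ((v : R) + h - (m + 1) * x) + (1 - x) := by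
      push_cast; ring
    rw [e1, e2, add_pow, add_pow, Nat.sub_add_comm hv', pow_succ x, pow_succ (1 - x)]
    have e3 : (∑ s ∈ range (r + 1), (r.choose s : R) * ((v : R) + h - (m + 1) * x) ^ s * bE x (r - s))
      = x * (∑ s ∈ range (r + 1), ((v : R) + h - (m + 1) * x) ^ s * (1 - x) ^ (r - s) * (r.choose s : R))
      + (1 - x) * (∑ s ∈ range (r + 1), ((v : R) + h - (m + 1) * x) ^ s * (- x) ^ (r - s) * (r.choose s : R)) := by
      rw [Finset.mul_sum, Finset.mul_sum, ← Finset.sum_add_distrib]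
      refine Finset.sum_congr rfl fun s _ => ?_
      unfold bE; ring
    rw [e3]; ring
  have h2 : momU x h (m + 1) r = ∑ s ∈ range (r + 1), (r.choose s : R) * momU x h m s * bE x (r - s) := by
    rw [h1]
    simp_rw [Finset.mul_sum]
    rw [Finset.sum_comm]
    refine Finset.sum_congr rfl fun s _ => ?_
    unfold momU
    rw [Finset.mul_sum, Finset.sum_mul]
    refine Finset.sum_congr rfl fun v _ => ?_
    ring
  rw [h2, Finset.sum_range_succ]
  simp [bE]; ring

theorem momU_eq {R : Type*} [CommRing R] (x h : R) (m : ℕ) : ∀ r K : ℕ, r ≤ K →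
    momU x h m r = ∑ l ∈ range (K + 1), cC x h l r * (m.choose l : R) := by
  induction m with
  | zero =>
    intro r K _
    rw [Finset.sum_range_succ']
    simp [momU, cC]
  | succ m ih =>
    intro r K hK
    rw [momU_succ, ih r K hK, Finset.sum_range_succ', Finset.sum_range_succ' _ K]
    simp only [Nat.choose_succ_succ, Nat.choose_zero_right, Nat.cast_add, mul_add, Finset.sum_add_distrib]
    have : ∑ s ∈ range r, (r.choose s : R) * momU x h m s * bE x (r - s)
        = ∑ l ∈ range K, cC x h (l + 1) r * (m.choose l : R) := by
      simp only [cC, Finset.sum_mul]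
      rw [Finset.sum_comm]
      refine Finset.sum_congr rfl fun s hs => ?_
      have hs' : s < r := by simpa using hs
      obtain ⟨K, rfl⟩ : ∃ K', K = K' + 1 := ⟨K - 1, by omega⟩
      rw [ih s K (by omega), Finset.mul_sum, Finset.sum_mul]
      refine Finset.sum_congr rfl fun l _ => ?_
      ring
    rw [this]; ring

theorem bE_one {R : Type*} [CommRing R] (x : R) : bE x 1 = 0 := by unfold bE; ring
theorem bE_two {R : Type*} [CommRing R] (x : R) : bE x 2 = x * (1 - x) := by unfold bE; ring

theorem cC_zero {R : Type*} [CommRing R] (x h : R) (l : ℕ) : ∀ r, r < 2 * l → cC x h l r = 0 := by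
  induction l with
  | zero => intro r hr; omega
  | succ l ih =>
    intro r hr
    rw [cC]
    refine Finset.sum_eq_zero fun s hs => ?_
    have hs' : s < r := by simpa using hs
    by_cases h1 : s < 2 * l
    · rw [ih s h1]; simp
    · have : r - s = 1 := by omega
      rw [this, bE_one, mul_zero]

theorem cC_lead {R : Type*} [CommRing R] (x h : R) (l : ℕ) :
    2 ^ l * cC x h l (2 * l) = ((2 * l).factorial : R) * (x ^ l * (1 - x) ^ l) := by
  induction l with
  | zero => simp [cC]
  | succ l ih =>
    have e : cC x h (l + 1) (2 * (l + 1)) = ((2 * l + 2).choose 2 : R) * cC x h l (2 * l) * (x * (1 - x)) := by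
      rw [cC, Finset.sum_eq_single (2 * l)]
      · rw [show 2 * (l + 1) - 2 * l = 2 by omega, bE_two, show 2 * (l + 1) = 2 * l + 2 by ring,
          ← Nat.choose_symm_add]
      · intro s hs hne
        have hs' : s < 2 * (l + 1) := by simpa using hs
        by_cases h1 : s < 2 * l
        · rw [cC_zero x h l s h1]; simp
        · have : 2 * (l + 1) - s = 1 := by omega
          rw [this, bE_one, mul_zero]
      · intro hh; simp at hh
    have f : (2 : R) * ((2 * l + 2).choose 2 : R) * ((2 * l).factorial : R) = ((2 * (l + 1)).factorial : R) := by
      have := Nat.choose_mul_factorial_mul_factorial (show 2 ≤ 2 * l + 2 by omega)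
      rw [show 2 * l + 2 - 2 = 2 * l by omega] at this
      rw [show 2 * (l + 1) = 2 * l + 2 by ring, ← this]
      push_cast [Nat.factorial]; ring
    rw [e, ← f]
    linear_combination (2 * ((2 * l + 2).choose 2 : R) * (x * (1 - x))) * ih

/-- Integration over the unit interval. -/
noncomputable def LI : ℝ[X] →ₗ[ℝ] ℝ :=
  Polynomial.lsum (fun i => (1 / ((i : ℝ) + 1)) • (LinearMap.id : ℝ →ₗ[ℝ] ℝ))

theorem LI_beta (j : ℕ) : ∀ i : ℕ, LI (X ^ i * (1 - X) ^ j) =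
    (i.factorial : ℝ) * j.factorial / ((i + j + 1).factorial : ℝ) := by
  induction j with
  | zero =>
    intro i
    have : LI (X ^ i) = 1 / ((i : ℝ) + 1) := by
      rw [← Polynomial.monomial_one_right_eq_X_pow]
      simp [LI, Polynomial.lsum_apply, Polynomial.sum_monomial_index]
    simp only [pow_zero, mul_one, this]
    rw [add_zero, Nat.factorial_succ]
    have := Nat.factorial_ne_zero i
    push_cast; field_simp; simp
  | succ j ih =>
    intro i
    have e : (X ^ i * (1 - X) ^ (j + 1) : ℝ[X]) = X ^ i * (1 - X) ^ j - X ^ (i + 1) * (1 - X) ^ j := by ring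
    rw [e, map_sub, ih, ih]
    rw [show i + 1 + j + 1 = (i + j + 1) + 1 by ring, show i + (j + 1) + 1 = (i + j + 1) + 1 by ring,
      Nat.factorial_succ (i + j + 1), Nat.factorial_succ i, Nat.factorial_succ j]
    have := Nat.factorial_ne_zero (i + j + 1)
    push_cast; field_simp; ring

theorem rise_nat (v j : ℕ) : rise ((v : ℝ) + 1) j = ((v + j).factorial : ℝ) / v.factorial := by
  induction j with
  | zero =>
    have := Nat.factorial_ne_zero v
    simp [rise]; field_simp
  | succ j ih =>
    unfold rise at *
    rw [Finset.prod_range_succ, ih, ← add_assoc, Nat.factorial_succ]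
    push_cast; ring

theorem LI_momU (m a : ℕ) : LI (momU X (C (1 / 2)) m a) * ((m : ℝ) + 1) =
    ∑ j ∈ range (a + 1), ∑ v ∈ range (m + 1), (a.choose j : ℝ) * (-1 : ℝ) ^ j * ((m : ℝ) + 1) ^ j *
      (((v : ℝ) + 1 / 2) ^ (a - j) * rise ((v : ℝ) + 1) j) / rise (((m + 1 : ℕ) : ℝ) + 1) j := by
  have e : (momU X (C (1 / 2)) m a : ℝ[X]) = ∑ j ∈ range (a + 1), ∑ v ∈ range (m + 1),
      ((m.choose v : ℝ) * (a.choose j : ℝ) * (-1 : ℝ) ^ j * ((m : ℝ) + 1) ^ j * ((v : ℝ) + 1 / 2) ^ (a - j)) •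
        (X ^ (v + j) * (1 - X) ^ (m - v)) := by
    unfold momU
    rw [Finset.sum_comm]
    refine Finset.sum_congr rfl fun v _ => ?_
    have : ((v : ℝ[X]) + C (1 / 2) - ((m : ℝ[X]) + 1) * X) = C (-1 * ((m : ℝ) + 1)) * X + C ((v : ℝ) + 1 / 2) := by
      simp; ring
    rw [this, add_pow, Finset.mul_sum, Finset.mul_sum]
    refine Finset.sum_congr rfl fun j _ => ?_
    rw [Polynomial.smul_eq_C_mul]
    simp only [map_mul, map_pow, mul_pow, Polynomial.C_eq_natCast]
    rw [pow_add]
    ring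
  rw [e]
  simp only [map_sum, map_smul, Finset.sum_mul]
  refine Finset.sum_congr rfl fun j _ => Finset.sum_congr rfl fun v hv => ?_
  have hv' : v ≤ m := by simp at hv; omega
  rw [LI_beta, rise_nat, rise_nat, show v + j + (m - v) + 1 = m + 1 + j by omega, Nat.factorial_succ,
    ← Nat.choose_mul_factorial_mul_factorial hv']
  have h1 := Nat.factorial_ne_zero v
  have h2 := Nat.factorial_ne_zero (m + 1 + j)
  have h3 := Nat.factorial_ne_zero (m - v)
  have h4 := (Nat.choose_pos hv').ne'
  simp only [smul_eq_mul]
  push_cast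
  field_simp

theorem choose_approx (k n : ℕ) (hk : 0 < k) (hn : k + 1 ≤ n) :
    |((n - 1).choose k : ℝ) * k.factorial - (n : ℝ) ^ k| ≤ (k : ℝ) ^ 2 * (n : ℝ) ^ (k - 1) := by
  have e : ((n - 1).choose k : ℝ) * k.factorial = ((n - 1).descFactorial k : ℝ) := by
    rw [Nat.descFactorial_eq_factorial_mul_choose]; push_cast; ring
  have hn0 : (0 : ℝ) < n := by exact_mod_cast (by omega : 0 < n)
  have up : ((n - 1).descFactorial k : ℝ) ≤ (n : ℝ) ^ k := by
    exact_mod_cast (Nat.descFactorial_le_pow (n - 1) k).trans (Nat.pow_le_pow_left (by omega) k)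
  have lo : ((n : ℝ) - k) ^ k ≤ ((n - 1).descFactorial k : ℝ) := by
    have := Nat.pow_sub_le_descFactorial (n - 1) k
    rw [show n - 1 + 1 - k = n - k by omega] at this
    have h2 : ((n - k : ℕ) : ℝ) ^ k ≤ ((n - 1).descFactorial k : ℝ) := by exact_mod_cast this
    rwa [Nat.cast_sub (by omega)] at h2
  have hkn : (k : ℝ) / n ≤ 1 := by
    rw [div_le_one hn0]; exact_mod_cast (by omega : k ≤ n)
  have ber := one_add_mul_le_pow (show (-2 : ℝ) ≤ -((k : ℝ) / n) by linarith) k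
  have h3 : (n : ℝ) ^ k - (k : ℝ) ^ 2 * (n : ℝ) ^ (k - 1) ≤ ((n : ℝ) - k) ^ k := by
    have e1 : ((n : ℝ) - k) ^ k = (n : ℝ) ^ k * (1 + -((k : ℝ) / n)) ^ k := by
      rw [← mul_pow]; congr 1; field_simp; ring
    have e2 : (n : ℝ) ^ k = (n : ℝ) ^ (k - 1) * n := by rw [← pow_succ]; congr 1; omega
    rw [e1]
    refine le_trans (le_of_eq ?_) (mul_le_mul_of_nonneg_left ber (by positivity))
    rw [e2]; field_simp; ring
  rw [e, abs_le]
  constructor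
  · linarith
  · have : 0 ≤ (k : ℝ) ^ 2 * (n : ℝ) ^ (k - 1) := by positivity
    linarith

theorem stmt0 (a : ℕ) (ha : 0 < a) (hae : Even a) (S : ℕ → ℝ)
    (hS : ∀ n : ℕ, 1 ≤ n →
      S n = ∑ j ∈ Finset.range (a + 1), ∑ i ∈ Finset.Icc 1 n,
        (1 / (n : ℝ) ^ a) * (a.choose j : ℝ) * (-1 : ℝ) ^ j * (n : ℝ) ^ j *
          (((i : ℝ) - 1 / 2) ^ (a - j) * rise (i : ℝ) j) / rise ((n : ℝ) + 1) j) :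
    ∃ C > 0, ∃ N : ℕ, ∀ n : ℕ, N ≤ n →
      |S n - ((Nat.factorial (a / 2) : ℝ) / (2 ^ (a / 2) * (1 + (a : ℝ)))) *
          (n : ℝ) ^ ((1 : ℝ) - (a : ℝ) / 2)|
        ≤ C * (n : ℝ) ^ (-(a : ℝ) / 2) := by
  obtain ⟨k, rfl⟩ := hae
  obtain ⟨d, hd⟩ : ∃ d : ℕ → ℝ, ∀ l, d l = LI (cC X (Polynomial.C (1 / 2)) l (k + k)) := ⟨_, fun _ => rfl⟩
  have hk : 0 < k := by omega
  have hk2 : (k + k) / 2 = k := by omega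
  have hdz : ∀ l, k < l → d l = 0 := by
    intro l hl
    rw [hd, cC_zero _ _ _ _ (by omega), map_zero]
  have hdk : d k = (k.factorial : ℝ) / (2 ^ k * (1 + ((k + k : ℕ) : ℝ))) * k.factorial := by
    have h1 := congrArg LI (cC_lead (X : ℝ[X]) (Polynomial.C (1 / 2)) k)
    have e1 : (2 ^ k * cC X (Polynomial.C (1 / 2)) k (2 * k) : ℝ[X]) =
        ((2 : ℝ) ^ k) • cC X (Polynomial.C (1 / 2)) k (2 * k) := by
      rw [Polynomial.smul_eq_C_mul, map_pow, show (Polynomial.C (2 : ℝ)) = 2 from rfl]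
    have e2 : (((2 * k).factorial : ℝ[X]) * (X ^ k * (1 - X) ^ k)) =
        (((2 * k).factorial : ℝ)) • (X ^ k * (1 - X) ^ k) := by
      rw [Polynomial.smul_eq_C_mul]; simp
    rw [e1, e2, map_smul, map_smul, LI_beta, two_mul, ← hd, Nat.factorial_succ (k + k)] at h1
    have := Nat.factorial_ne_zero (k + k)
    simp only [smul_eq_mul] at h1
    push_cast at h1 ⊢
    field_simp at h1 ⊢
    linarith
  have hSn : ∀ n : ℕ, 1 ≤ n → S n = (n : ℝ) / (n : ℝ) ^ (k + k) *
      ∑ l ∈ range (k + 1), d l * ((n - 1).choose l : ℝ) := by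
    intro n hn
    obtain ⟨m, rfl⟩ : ∃ m, n = m + 1 := ⟨n - 1, by omega⟩
    have e1 : LI (momU X (Polynomial.C (1 / 2)) m (k + k)) = ∑ l ∈ range (k + 1), d l * (m.choose l : ℝ) := by
      rw [momU_eq _ _ m (k + k) (k + k) le_rfl, map_sum]
      symm
      refine (Finset.sum_subset (range_subset_range.2 (show k + 1 ≤ k + k + 1 by omega)) ?_).trans ?_
      · intro l _ hl
        rw [hdz l (by simpa using hl), zero_mul]
      · refine Finset.sum_congr rfl fun l _ => ?_
        rw [hd, mul_comm (cC _ _ _ _), ← Polynomial.C_eq_natCast, ← Polynomial.smul_eq_C_mul, map_smul,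
          smul_eq_mul, mul_comm]
    rw [hS _ hn, Nat.add_sub_cancel, ← e1]
    have e2 := LI_momU m (k + k)
    have e3 : ((m + 1 : ℕ) : ℝ) / ((m + 1 : ℕ) : ℝ) ^ (k + k) * LI (momU X (Polynomial.C (1 / 2)) m (k + k))
      = (1 / ((m + 1 : ℕ) : ℝ) ^ (k + k)) * (LI (momU X (Polynomial.C (1 / 2)) m (k + k)) * ((m : ℝ) + 1)) := by
      push_cast; ring
    rw [e3, e2, Finset.mul_sum]
    refine Finset.sum_congr rfl fun j _ => ?_
    rw [Finset.mul_sum]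
    symm
    refine Finset.sum_bij (fun v _ => v + 1) ?_ ?_ ?_ ?_
    · intro v hv
      simp only [Finset.mem_range, Finset.mem_Icc] at *
      omega
    · intro v _ w _ h
      simpa using h
    · intro i hi
      simp only [Finset.mem_Icc] at hi
      exact ⟨i - 1, by simp only [Finset.mem_range]; omega, by omega⟩
    · intro v _
      have : (((v + 1 : ℕ) : ℝ) - 1 / 2) = (v : ℝ) + 1 / 2 := by push_cast; ring
      rw [this]
      push_cast
      ring
  refine ⟨(∑ l ∈ range k, |d l|) + |d k| * (k : ℝ) ^ 2 + 1, by positivity, k + 1, fun n hn => ?_⟩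
  have hn0 : (0 : ℝ) < n := by exact_mod_cast (by omega : 0 < n)
  have hn1 : (1 : ℝ) ≤ n := by exact_mod_cast (by omega : 1 ≤ n)
  have p1 : (n : ℝ) ^ ((1 : ℝ) - ((k + k : ℕ) : ℝ) / 2) = (n : ℝ) / (n : ℝ) ^ (k + k) * (n : ℝ) ^ k := by
    rw [Real.rpow_sub hn0, Real.rpow_one, show ((k + k : ℕ) : ℝ) / 2 = (k : ℝ) by push_cast; ring,
      Real.rpow_natCast, pow_add]
    field_simp
  have p2 : (n : ℝ) ^ (-((k + k : ℕ) : ℝ) / 2) = (n : ℝ) / (n : ℝ) ^ (k + k) * (n : ℝ) ^ (k - 1) := by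
    rw [show -((k + k : ℕ) : ℝ) / 2 = -(k : ℝ) by push_cast; ring, Real.rpow_neg hn0.le,
      Real.rpow_natCast, pow_add]
    have e2 : (n : ℝ) ^ k = (n : ℝ) ^ (k - 1) * n := by rw [← pow_succ]; congr 1; omega
    rw [e2]
    field_simp
  rw [hk2, p1, p2, hSn n (by omega)]
  set q : ℝ := (n : ℝ) / (n : ℝ) ^ (k + k) with hq
  have hq0 : 0 ≤ q := by positivity
  set c : ℝ := (k.factorial : ℝ) / (2 ^ k * (1 + ((k + k : ℕ) : ℝ))) with hc
  have hf1 : (1 : ℝ) ≤ k.factorial := by exact_mod_cast Nat.factorial_pos k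
  have hc0 : 0 ≤ c := by positivity
  have hcd : c ≤ |d k| := by
    rw [hdk]; exact le_trans (le_mul_of_one_le_right hc0 hf1) (le_abs_self _)
  have main : |∑ l ∈ range (k + 1), d l * ((n - 1).choose l : ℝ) - c * (n : ℝ) ^ k| ≤
      ((∑ l ∈ range k, |d l|) + |d k| * (k : ℝ) ^ 2 + 1) * (n : ℝ) ^ (k - 1) := by
    have e : ∑ l ∈ range (k + 1), d l * ((n - 1).choose l : ℝ) - c * (n : ℝ) ^ k =
        ∑ l ∈ range k, d l * ((n - 1).choose l : ℝ) +
          c * (((n - 1).choose k : ℝ) * k.factorial - (n : ℝ) ^ k) := by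
      rw [Finset.sum_range_succ, hdk]; ring
    rw [e]
    have b1 : |∑ l ∈ range k, d l * ((n - 1).choose l : ℝ)| ≤ (∑ l ∈ range k, |d l|) * (n : ℝ) ^ (k - 1) := by
      rw [Finset.sum_mul]
      refine (Finset.abs_sum_le_sum_abs _ _).trans (Finset.sum_le_sum fun l hl => ?_)
      have hl' : l < k := by simpa using hl
      rw [abs_mul, Nat.abs_cast]
      refine mul_le_mul_of_nonneg_left ?_ (abs_nonneg _)
      have : (n - 1).choose l ≤ n ^ (k - 1) :=
        (Nat.choose_le_pow _ _).trans ((Nat.pow_le_pow_left (by omega) l).trans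
          (Nat.pow_le_pow_right (by omega) (by omega)))
      exact_mod_cast this
    have b2 : |c * (((n - 1).choose k : ℝ) * k.factorial - (n : ℝ) ^ k)| ≤
        |d k| * ((k : ℝ) ^ 2 * (n : ℝ) ^ (k - 1)) := by
      rw [abs_mul, abs_of_nonneg hc0]
      exact mul_le_mul hcd (choose_approx k n hk hn) (abs_nonneg _) (abs_nonneg _)
    have b3 : 0 ≤ (n : ℝ) ^ (k - 1) := by positivity
    refine (abs_add_le _ _).trans ?_
    linarith
  have : q * ∑ l ∈ range (k + 1), d l * ((n - 1).choose l : ℝ) - c * (q * (n : ℝ) ^ k) =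
      q * (∑ l ∈ range (k + 1), d l * ((n - 1).choose l : ℝ) - c * (n : ℝ) ^ k) := by ring
  rw [this, abs_mul, abs_of_nonneg hq0]
  refine (mul_le_mul_of_nonneg_left main hq0).trans (le_of_eq ?_)
  ring
end

section
/- Fix a real number $a > 0$ and set $p = \frac{9}{4}(2+a)$; let $x_0 \ge 3$ be the real solution of $\frac{x}{p \ln x} = 3$. Let $f > 6$ be a real constant and for each $n$ set $r_n = \frac{f}{2n}$. Then there exist a constant $C > 0$ and, for each integer $n \ge \lceil x_0 \rceil$, a measurable map $\Phi_n : [0,1]^n \to [0,1]^n$ such that: (i) for every input $x \in [0,1]^n$, the output positions $\Phi_n(x)_1, \dots, \Phi_n(x)_n$ cover $[0,1]$ with radius $r_n$, i.e. every point of $[0,1]$ is within distance $r_n$ of some $\Phi_n(x)_i$; and (ii) if $X = (X_1, \dots, X_n)$ are $n$ points placed independently and uniformly at random on $[0,1]$, then $\mathbb{E}\left[\sum_{i=1}^{n} |X_i - \Phi_n(X)_i|^a\right] \le C \, \frac{1}{n^{a/2 - 1}} \left(\frac{\ln n}{n}\right)^{a/2}$. -/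
open MeasureTheory

/-- The uniform (product Lebesgue) probability measure on `[0,1]ⁿ`. -/
noncomputable def uniformCube (n : ℕ) : Measure (Fin n → ℝ) :=
  Measure.pi fun _ => volume.restrict (Set.Icc 0 1)


theorem hall_cells (n m : ℕ) (hmn : m ≤ n) (c : Fin n → ℕ) (hc : ∀ i, c i < m) (d : Fin m → ℕ)
    (hd : ∀ (j : Fin m) (p q : ℕ), p ≤ j → (j : ℕ) < q → q ≤ m →
      (Finset.univ.filter (fun i => p ≤ c i ∧ c i < q)).card < q - p → q - p ≤ d j) :
    ∃ σ : Fin m → Fin n, Function.Injective σ ∧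
      ∀ j, c (σ j) ≤ j + d j ∧ (j : ℕ) ≤ c (σ j) + d j := by
  classical
  have key := (Finset.all_card_le_biUnion_card_iff_exists_injective
    (fun j : Fin m => Finset.univ.filter (fun i : Fin n => c i ≤ j + d j ∧ (j : ℕ) ≤ c i + d j))).1
  simp only [Finset.mem_filter, Finset.mem_univ, true_and] at key
  apply key
  intro s
  set U : ℕ → Prop := fun k => ∃ j ∈ s, k ≤ (j : ℕ) + d j ∧ (j : ℕ) ≤ k + d j with hU
  have hsU : ∀ j ∈ s, U (j : ℕ) := fun j hj => ⟨j, hj, by omega, by omega⟩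
  have block : ∀ p q : ℕ, q ≤ m → (p = 0 ∨ ¬ U (p - 1)) → (q = m ∨ ¬ U q) →
      (∀ k, p ≤ k → k < q → U k) →
      (s.filter (fun j : Fin m => p ≤ (j : ℕ) ∧ (j : ℕ) < q)).card ≤
        (Finset.univ.filter (fun i => U (c i) ∧ p ≤ c i ∧ c i < q)).card := by
    intro p q hqm hp hq hall
    have hB : (Finset.univ.filter (fun i => U (c i) ∧ p ≤ c i ∧ c i < q)) =
        (Finset.univ.filter (fun i => p ≤ c i ∧ c i < q)) := by
      ext i
      simp only [Finset.mem_filter, Finset.mem_univ, true_and]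
      exact ⟨fun h => h.2, fun h => ⟨hall _ h.1 h.2, h⟩⟩
    rw [hB]
    have hA : (s.filter (fun j : Fin m => p ≤ (j : ℕ) ∧ (j : ℕ) < q)).card ≤ q - p := by
      rw [← Nat.card_Ico]
      apply Finset.card_le_card_of_injOn (fun j : Fin m => (j : ℕ))
      · intro j hj
        simp at hj ⊢
        exact hj.2
      · intro x _ y _ h
        exact Fin.ext h
    by_contra hlt
    push Not at hlt
    have hdef := lt_of_lt_of_le hlt hA
    obtain ⟨j, hj⟩ := Finset.card_pos.1 (lt_of_le_of_lt (Nat.zero_le _) hlt)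
    simp only [Finset.mem_filter] at hj
    obtain ⟨hjs, hpj, hjq⟩ := hj
    have h1 := hd j p q hpj hjq hqm hdef
    have h2 : p = 0 := by
      rcases hp with hp | hp
      · exact hp
      · by_contra h0
        exact hp ⟨j, hjs, by omega, by omega⟩
    have h3 : q = m := by
      rcases hq with hq | hq
      · exact hq
      · exfalso
        exact hq ⟨j, hjs, by omega, by omega⟩
    have h4 : (Finset.univ.filter (fun i => p ≤ c i ∧ c i < q)) = Finset.univ := by
      ext i
      have := hc i
      simp
      omega
    rw [h4] at hdef
    simp at hdef
    omega
  have main : ∀ q : ℕ, q ≤ m → (q = m ∨ ¬ U q) →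
      (s.filter (fun j : Fin m => (j : ℕ) < q)).card ≤
        (Finset.univ.filter (fun i => U (c i) ∧ c i < q)).card := by
    intro q
    induction q using Nat.strong_induction_on with
    | _ q ih =>
      intro hqm hq
      by_cases hall : ∀ k, k < q → U k
      · have := block 0 q hqm (Or.inl rfl) hq (fun k _ h => hall k h)
        simpa using this
      · push Not at hall
        obtain ⟨k0, hk0, hk0U⟩ := hall
        have hne : ((Finset.range q).filter (fun k => ¬ U k)).Nonempty :=
          ⟨k0, by simp [hk0, hk0U]⟩
        obtain ⟨k, hk, hmax⟩ := Finset.exists_max_image _ (fun k => k) hne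
        simp only [Finset.mem_filter, Finset.mem_range] at hk hmax
        have i1 := ih k hk.1 (by omega) (Or.inr hk.2)
        have i2 := block (k + 1) q hqm (Or.inr (by simpa using hk.2)) hq (by
          intro l hl hlq
          by_contra hlU
          have := hmax l ⟨hlq, hlU⟩
          omega)
        have e1 : s.filter (fun j : Fin m => (j : ℕ) < q) ⊆ s.filter (fun j : Fin m => (j : ℕ) < k) ∪
            s.filter (fun j : Fin m => k + 1 ≤ (j : ℕ) ∧ (j : ℕ) < q) := by
          intro j hj
          simp only [Finset.mem_filter, Finset.mem_union] at hj ⊢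
          have : (j : ℕ) ≠ k := by
            intro h
            exact hk.2 (h ▸ hsU j hj.1)
          by_cases hjk : (j : ℕ) < k
          · exact Or.inl ⟨hj.1, hjk⟩
          · exact Or.inr ⟨hj.1, by omega, hj.2⟩
        have e2 : Finset.univ.filter (fun i => U (c i) ∧ c i < k) ∪
            Finset.univ.filter (fun i => U (c i) ∧ k + 1 ≤ c i ∧ c i < q) ⊆
            Finset.univ.filter (fun i => U (c i) ∧ c i < q) := by
          intro i hi
          simp only [Finset.mem_filter, Finset.mem_union, Finset.mem_univ, true_and] at hi ⊢
          rcases hi with hi | hi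
          · exact ⟨hi.1, by omega⟩
          · exact ⟨hi.1, by omega⟩
        have e3 : Disjoint (Finset.univ.filter (fun i => U (c i) ∧ c i < k))
            (Finset.univ.filter (fun i => U (c i) ∧ k + 1 ≤ c i ∧ c i < q)) := by
          rw [Finset.disjoint_filter]
          intro i _ h1 h2
          omega
        calc _ ≤ _ := Finset.card_le_card e1
          _ ≤ _ := Finset.card_union_le _ _
          _ ≤ _ := Nat.add_le_add i1 i2
          _ = _ := (Finset.card_union_of_disjoint e3).symm
          _ ≤ _ := Finset.card_le_card e2
  have fin := main m le_rfl (Or.inl rfl)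
  rw [Finset.filter_true_of_mem (fun j _ => j.2)] at fin
  refine fin.trans (Finset.card_le_card ?_)
  intro i hi
  simp only [Finset.mem_filter, Finset.mem_univ, true_and, Finset.mem_biUnion, hU] at hi ⊢
  exact hi.1

/-- Measurable selection of a cost-minimal candidate map among finitely many. -/
theorem exists_measurable_argmin {T X Y : Type*} [Finite T] [Nonempty T] [MeasurableSpace X]
    [MeasurableSpace Y] (F : T → X → Y) (hF : ∀ t, Measurable (F t))
    (c : T → X → ℝ) (hc : ∀ t, Measurable (c t)) :
    ∃ Φ : X → Y, Measurable Φ ∧ ∀ x, ∃ t, Φ x = F t x ∧ ∀ t', c t x ≤ c t' x := by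
  classical
  obtain ⟨e, he⟩ := exists_surjective_nat T
  have hp : ∀ x, ∃ k, ∀ l, c (e k) x ≤ c (e l) x := by
    intro x
    obtain ⟨t, ht⟩ := Finite.exists_min (fun t => c t x)
    obtain ⟨k, rfl⟩ := he t
    exact ⟨k, fun l => ht _⟩
  have hm : Measurable fun x => Nat.find (hp x) := by
    apply measurable_find
    intro k
    rw [Set.ofPred_forall]
    exact MeasurableSet.iInter fun l => measurableSet_le (hc _) (hc _)
  have hu : Measurable (fun z : ℕ × X => F (e z.1) z.2) :=
    measurable_from_prod_countable_right fun k => hF (e k)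
  refine ⟨fun x => F (e (Nat.find (hp x))) x, hu.comp (hm.prodMk measurable_id), ?_⟩
  intro x
  refine ⟨_, rfl, fun t' => ?_⟩
  obtain ⟨l, rfl⟩ := he t'
  exact Nat.find_spec (hp x) l

/-- Clamped cell index. -/
theorem cell_dist (m : ℕ) (hm : 0 < m) (t : ℝ) (ht : t ∈ Set.Icc (0 : ℝ) 1) (j d : ℕ)
    (h1 : min ⌊m * t⌋₊ (m - 1) ≤ j + d) (h2 : j ≤ min ⌊m * t⌋₊ (m - 1) + d) :
    |t - (j + 1 / 2) / m| ≤ (d + 1) / m := by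
  have hm' : (0 : ℝ) < m := by exact_mod_cast hm
  set k := min ⌊m * t⌋₊ (m - 1) with hk
  have a1 : (k : ℝ) ≤ m * t := by
    have h := Nat.floor_le (show (0 : ℝ) ≤ m * t by have := ht.1; positivity)
    have h' : (k : ℝ) ≤ ⌊m * t⌋₊ := by exact_mod_cast min_le_left _ _
    linarith
  have a2 : m * t ≤ (k : ℝ) + 1 := by
    by_cases hc : ⌊m * t⌋₊ ≤ m - 1
    · have : k = ⌊m * t⌋₊ := min_eq_left hc
      rw [this]
      exact (Nat.lt_floor_add_one _).le
    · have : k = m - 1 := min_eq_right (by omega)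
      have h3 : (k : ℝ) + 1 = m := by
        have : k + 1 = m := by omega
        exact_mod_cast this
      rw [h3]
      have := ht.2
      nlinarith
  have b1 : (k : ℝ) ≤ j + d := by exact_mod_cast h1
  have b2 : (j : ℝ) ≤ k + d := by exact_mod_cast h2
  have e : t - (j + 1 / 2) / m = (m * t - j - 1 / 2) / m := by field_simp; ring
  rw [e, abs_div, abs_of_pos hm']
  gcongr
  rw [abs_le]
  constructor <;> linarith

/-- Weight `1/2` on the cells `[p,q)`, weight `1` elsewhere. -/
noncomputable def hw (m p q : ℕ) (t : ℝ) : ℝ :=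
  if t ∈ Set.Ico ((p : ℝ) / m) ((q : ℝ) / m) then 1 / 2 else 1

theorem hw_pos (m p q : ℕ) (t : ℝ) : 0 < hw m p q t := by
  unfold hw; split_ifs <;> norm_num

theorem hw_eq (m p q : ℕ) : hw m p q = fun t =>
    1 - (Set.Ico ((p : ℝ) / m) ((q : ℝ) / m)).indicator (fun _ => (1 / 2 : ℝ)) t := by
  classical
  funext t
  unfold hw
  rw [Set.indicator_apply]
  split_ifs <;> norm_num

theorem hw_integrable (m p q : ℕ) :
    Integrable (hw m p q) (volume.restrict (Set.Icc (0 : ℝ) 1)) := by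
  rw [hw_eq]
  exact (integrable_const _).sub ((integrable_const _).indicator measurableSet_Ico)

theorem hw_integral (m p q : ℕ) (hm : 0 < m) (hpq : p ≤ q) (hq : q ≤ m) :
    ∫ t, hw m p q t ∂(volume.restrict (Set.Icc (0 : ℝ) 1)) = 1 - ((q : ℝ) - p) / (2 * m) := by
  have hm' : (0 : ℝ) < m := by exact_mod_cast hm
  have hq' : (q : ℝ) ≤ m := by exact_mod_cast hq
  have hpq' : (p : ℝ) ≤ q := by exact_mod_cast hpq
  rw [hw_eq, integral_sub (integrable_const _)
    ((integrable_const _).indicator measurableSet_Ico), integral_indicator measurableSet_Ico,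
    Measure.restrict_restrict measurableSet_Ico]
  have hsub : Set.Ico ((p : ℝ) / m) ((q : ℝ) / m) ∩ Set.Icc 0 1 =
      Set.Ico ((p : ℝ) / m) ((q : ℝ) / m) := by
    apply Set.inter_eq_left.2
    intro t ht
    refine ⟨le_trans (by positivity) ht.1, ht.2.le.trans ?_⟩
    rw [div_le_one hm']
    exact hq'
  rw [hsub]
  have h : (p : ℝ) / m ≤ q / m := by gcongr
  simp [Measure.real, ENNReal.toReal_ofReal (sub_nonneg.2 h)]
  field_simp

theorem prob_bound (n m p q : ℕ) (hm : 0 < m) (hpq : p ≤ q) (hq : q ≤ m) (hmn : 4 * m ≤ n) :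
    (2 : ℝ) ^ (q - p) * ∫ x, ∏ i, hw m p q (x i) ∂(uniformCube n) ≤
      Real.exp (-((q - p : ℕ) : ℝ)) := by
  have hm' : (0 : ℝ) < m := by exact_mod_cast hm
  have hq' : (q : ℝ) ≤ m := by exact_mod_cast hq
  have hpq' : (p : ℝ) ≤ q := by exact_mod_cast hpq
  have hmn' : 4 * (m : ℝ) ≤ n := by exact_mod_cast hmn
  unfold uniformCube
  rw [integral_fintype_prod_eq_pow (ι := Fin n) (hw m p q), hw_integral m p q hm hpq hq, Fintype.card_fin]
  set k := q - p with hk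
  have hkr : (q : ℝ) - p = k := by rw [hk, Nat.cast_sub hpq]
  rw [hkr]
  have h0 : 0 ≤ 1 - (k : ℝ) / (2 * m) := by
    rw [sub_nonneg, div_le_one (by positivity)]
    have : (0 : ℝ) ≤ p := by positivity
    linarith
  have h1 : (1 - (k : ℝ) / (2 * m)) ^ n ≤ Real.exp (-(2 * k)) := by
    calc _ ≤ (Real.exp (-((k : ℝ) / (2 * m)))) ^ n :=
          pow_le_pow_left₀ h0 (Real.one_sub_le_exp_neg _) _
      _ = Real.exp (n * (-((k : ℝ) / (2 * m)))) := (Real.exp_nat_mul _ _).symm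
      _ ≤ _ := by
        apply Real.exp_le_exp.2
        have : 2 * (k : ℝ) ≤ n * (k / (2 * m)) := by
          rw [← mul_div_assoc, le_div_iff₀ (by positivity)]
          have : (0 : ℝ) ≤ k := by positivity
          nlinarith
        linarith
  have h2 : (2 : ℝ) ^ k ≤ Real.exp k := by
    calc (2 : ℝ) ^ k ≤ (Real.exp 1) ^ k := by
          gcongr
          have := Real.exp_one_gt_d9
          linarith
      _ = _ := by rw [← Real.exp_nat_mul, mul_one]
  calc _ ≤ Real.exp k * Real.exp (-(2 * k)) := by gcongr
    _ = _ := by rw [← Real.exp_add]; congr 1; ring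

/-- Deficient intervals have large weight. -/
theorem one_le_weight (n m p q : ℕ) (hm : 0 < m) (hq : q ≤ m) (x : Fin n → ℝ)
    (hdef : (Finset.univ.filter
      (fun i => p ≤ min ⌊m * x i⌋₊ (m - 1) ∧ min ⌊m * x i⌋₊ (m - 1) < q)).card < q - p) :
    1 ≤ (2 : ℝ) ^ (q - p) * ∏ i, hw m p q (x i) := by
  classical
  have hm' : (0 : ℝ) < m := by exact_mod_cast hm
  unfold hw
  rw [Finset.prod_ite]
  simp only [Finset.prod_const, one_pow, mul_one]
  set S := Finset.univ.filter (fun i => x i ∈ Set.Ico ((p : ℝ) / m) ((q : ℝ) / m))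
  have hS : S.card ≤ q - p := by
    refine le_trans (Finset.card_le_card ?_) hdef.le
    intro i hi
    simp only [S, Finset.mem_filter, Finset.mem_univ, true_and, Set.mem_Ico] at hi ⊢
    have h1 : (p : ℝ) ≤ m * x i := by
      have := (div_le_iff₀ hm').1 hi.1
      linarith
    have h2 : m * x i < q := by
      have := (lt_div_iff₀ hm').1 hi.2
      linarith
    have h3 : p ≤ ⌊m * x i⌋₊ := Nat.le_floor h1
    have h4 : ⌊m * x i⌋₊ < q := (Nat.floor_lt (le_trans (by positivity) h1)).2 h2
    omega
  calc (1 : ℝ) = 2 ^ (q - p) * (1 / 2) ^ (q - p) := by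
        rw [← mul_pow]; norm_num
    _ ≤ _ := by
        apply mul_le_mul_of_nonneg_left _ (by positivity)
        exact pow_le_pow_of_le_one (by norm_num) (by norm_num) hS

/-- Pointwise majorant of the rescaled cost of target `j`. -/
noncomputable def maj (a : ℝ) (n m j : ℕ) (x : Fin n → ℝ) : ℝ :=
  1 + ∑ u ∈ Finset.range (j + 1), ∑ v ∈ Finset.range (m - j),
    ((u : ℝ) + v + 2) ^ a * (2 ^ ((j + 1 + v) - (j - u)) *
      ∏ i, hw m (j - u) (j + 1 + v) (x i))

theorem exists_d (a : ℝ) (ha : 0 < a) (n m j : ℕ) (hm : 0 < m) (x : Fin n → ℝ) :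
    ∃ d : ℕ, (∀ p q : ℕ, p ≤ j → j < q → q ≤ m →
      (Finset.univ.filter
        (fun i => p ≤ min ⌊m * x i⌋₊ (m - 1) ∧ min ⌊m * x i⌋₊ (m - 1) < q)).card < q - p →
          q - p ≤ d) ∧ ((d : ℝ) + 1) ^ a ≤ maj a n m j x := by
  classical
  set D : ℕ × ℕ → Prop := fun z => (Finset.univ.filter
        (fun i => z.1 ≤ min ⌊m * x i⌋₊ (m - 1) ∧ min ⌊m * x i⌋₊ (m - 1) < z.2)).card < z.2 - z.1
  set S := ((Finset.range (j + 1)) ×ˢ (Finset.Ioc j m)).filter D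
  have hnn : ∀ u v : ℕ, 0 ≤ ((u : ℝ) + v + 2) ^ a * (2 ^ ((j + 1 + v) - (j - u)) *
      ∏ i, hw m (j - u) (j + 1 + v) (x i)) := by
    intro u v
    have : 0 < ∏ i, hw m (j - u) (j + 1 + v) (x i) := Finset.prod_pos fun i _ => hw_pos _ _ _ _
    positivity
  rcases S.eq_empty_or_nonempty with hS | hS
  · refine ⟨0, ?_, ?_⟩
    · intro p q hp hq hqm hdef
      exfalso
      have : (p, q) ∈ S := by
        simp only [S, Finset.mem_filter, Finset.mem_product, Finset.mem_range, Finset.mem_Ioc]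
        exact ⟨⟨by omega, hq, hqm⟩, hdef⟩
      rw [hS] at this
      simp at this
    · unfold maj
      simp only [Nat.cast_zero, zero_add, Real.one_rpow, le_add_iff_nonneg_right]
      exact Finset.sum_nonneg fun u _ => Finset.sum_nonneg fun v _ => hnn u v
  · obtain ⟨⟨p, q⟩, hz, hmax⟩ := Finset.exists_max_image S (fun z => z.2 - z.1) hS
    simp only [S, Finset.mem_filter, Finset.mem_product, Finset.mem_range, Finset.mem_Ioc] at hz
    obtain ⟨⟨hp, hq, hqm⟩, hdef⟩ := hz
    refine ⟨q - p, ?_, ?_⟩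
    · intro p' q' hp' hq' hqm' hdef'
      refine hmax (p', q') ?_
      simp only [S, Finset.mem_filter, Finset.mem_product, Finset.mem_range, Finset.mem_Ioc]
      exact ⟨⟨by omega, hq', hqm'⟩, hdef'⟩
    · have hw1 := one_le_weight n m p q hm hqm x hdef
      obtain ⟨u, rfl⟩ : ∃ u, j = p + u := ⟨j - p, by omega⟩
      obtain ⟨v, rfl⟩ : ∃ v, q = p + u + 1 + v := ⟨q - (p + u + 1), by omega⟩
      have e : (((p + u + 1 + v - p : ℕ) : ℝ) + 1) = (u : ℝ) + v + 2 := by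
        have : p + u + 1 + v - p = u + v + 1 := by omega
        rw [this]; push_cast; ring
      rw [e]
      have hterm : ((u : ℝ) + v + 2) ^ a ≤ ((u : ℝ) + v + 2) ^ a *
          (2 ^ ((p + u + 1 + v) - (p + u - u)) *
            ∏ i, hw m (p + u - u) (p + u + 1 + v) (x i)) := by
        rw [Nat.add_sub_cancel]
        exact le_mul_of_one_le_right (by positivity) hw1
      have s1 := Finset.single_le_sum (f := fun v' : ℕ => ((u : ℝ) + v' + 2) ^ a *
          (2 ^ ((p + u + 1 + v') - (p + u - u)) *
            ∏ i, hw m (p + u - u) (p + u + 1 + v') (x i))) (fun v' _ => hnn u v')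
          (Finset.mem_range.2 (show v < m - (p + u) by omega))
      have s2 := Finset.single_le_sum (f := fun u' : ℕ => ∑ v' ∈ Finset.range (m - (p + u)),
          ((u' : ℝ) + v' + 2) ^ a * (2 ^ ((p + u + 1 + v') - (p + u - u')) *
            ∏ i, hw m (p + u - u') (p + u + 1 + v') (x i)))
          (fun u' _ => Finset.sum_nonneg fun v' _ => hnn u' v')
          (Finset.mem_range.2 (show u < p + u + 1 by omega))
      unfold maj
      linarith

noncomputable def gser (a : ℝ) (u : ℕ) : ℝ := ((u : ℝ) + 2) ^ a * Real.exp (-(u : ℝ))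

theorem gser_nonneg (a : ℝ) (u : ℕ) : 0 ≤ gser a u := by unfold gser; positivity

theorem gser_summable (a : ℝ) : Summable (gser a) := by
  have h := (summable_nat_add_iff 2).2 (Real.summable_pow_mul_exp_neg_nat_mul ⌈a⌉₊ one_pos)
  refine Summable.of_nonneg_of_le (gser_nonneg a) ?_ (h.mul_left (Real.exp 2))
  intro u
  unfold gser
  have h1 : ((u : ℝ) + 2) ^ a ≤ ((u : ℝ) + 2) ^ ⌈a⌉₊ := by
    rw [← Real.rpow_natCast]
    exact Real.rpow_le_rpow_of_exponent_le (by linarith [(Nat.cast_nonneg u : (0 : ℝ) ≤ u)]) (Nat.le_ceil a)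
  have h2 : Real.exp (-(u : ℝ)) = Real.exp 2 * Real.exp (-1 * ((u + 2 : ℕ) : ℝ)) := by
    rw [← Real.exp_add]; congr 1; push_cast; ring
  rw [h2]
  push_cast
  calc _ ≤ ((u : ℝ) + 2) ^ ⌈a⌉₊ * (Real.exp 2 * Real.exp (-1 * ((u : ℝ) + 2))) := by gcongr
    _ = _ := by ring

theorem maj_term_integrable (n m p q : ℕ) :
    Integrable (fun x : Fin n → ℝ => ∏ i, hw m p q (x i)) (uniformCube n) := by
  unfold uniformCube
  exact Integrable.fintype_prod (f := fun _ => hw m p q) fun _ => hw_integrable m p q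

instance uniformCube_prob (n : ℕ) : IsProbabilityMeasure (uniformCube n) := by
  have : IsProbabilityMeasure (volume.restrict (Set.Icc (0 : ℝ) 1)) := ⟨by simp⟩
  unfold uniformCube
  infer_instance

theorem maj_integrable (a : ℝ) (n m j : ℕ) : Integrable (maj a n m j) (uniformCube n) := by
  unfold maj
  refine (integrable_const _).add ?_
  refine integrable_finsetSum _ fun u _ => integrable_finsetSum _ fun v _ => ?_
  exact ((maj_term_integrable n m _ _).const_mul _).const_mul _

theorem maj_integral (a : ℝ) (ha : 0 < a) (n m j : ℕ) (hm : 0 < m) (hj : j < m) (hmn : 4 * m ≤ n) :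
    ∫ x, maj a n m j x ∂(uniformCube n) ≤ 1 + (∑' u, gser a u) ^ 2 := by
  have hIntA : ∀ u v : ℕ, Integrable (fun x : Fin n → ℝ => ((u : ℝ) + v + 2) ^ a *
      (2 ^ ((j + 1 + v) - (j - u)) * ∏ i, hw m (j - u) (j + 1 + v) (x i))) (uniformCube n) :=
    fun u v => ((maj_term_integrable n m _ _).const_mul _).const_mul _
  unfold maj
  rw [integral_add (integrable_const _)
    (integrable_finsetSum _ fun u _ => integrable_finsetSum _ fun v _ => hIntA u v),
    integral_finsetSum _ (fun u _ => integrable_finsetSum _ fun v _ => hIntA u v)]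
  simp only [integral_const, probReal_univ, smul_eq_mul, mul_one]
  gcongr
  calc _ ≤ ∑ u ∈ Finset.range (j + 1), ∑ v ∈ Finset.range (m - j), gser a u * gser a v := by
        refine Finset.sum_le_sum fun u hu => ?_
        rw [integral_finsetSum _ (fun v _ => hIntA u v)]
        refine Finset.sum_le_sum fun v hv => ?_
        rw [Finset.mem_range] at hu hv
        rw [integral_const_mul, integral_const_mul]
        have hb := prob_bound n m (j - u) (j + 1 + v) hm (by omega) (by omega) hmn
        have e : (((j + 1 + v - (j - u) : ℕ) : ℝ)) = (u : ℝ) + v + 1 := by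
          have : j + 1 + v - (j - u) = u + v + 1 := by omega
          rw [this]; push_cast; ring
        rw [e] at hb
        have h1 : ((u : ℝ) + v + 2) ^ a ≤ ((u : ℝ) + 2) ^ a * ((v : ℝ) + 2) ^ a := by
          rw [← Real.mul_rpow (by positivity) (by positivity)]
          apply Real.rpow_le_rpow (by positivity) _ ha.le
          have hu0 : (0 : ℝ) ≤ u := by positivity
          have hv0 : (0 : ℝ) ≤ v := by positivity
          nlinarith [mul_nonneg hu0 hv0]
        have h2 : Real.exp (-((u : ℝ) + v + 1)) ≤ Real.exp (-(u : ℝ)) * Real.exp (-(v : ℝ)) := by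
          rw [← Real.exp_add]
          apply Real.exp_le_exp.2
          linarith
        calc _ ≤ ((u : ℝ) + v + 2) ^ a * Real.exp (-((u : ℝ) + v + 1)) :=
              mul_le_mul_of_nonneg_left hb (by positivity)
          _ ≤ (((u : ℝ) + 2) ^ a * ((v : ℝ) + 2) ^ a) *
              (Real.exp (-(u : ℝ)) * Real.exp (-(v : ℝ))) := by gcongr
          _ = _ := by unfold gser; ring
    _ = (∑ u ∈ Finset.range (j + 1), gser a u) * (∑ v ∈ Finset.range (m - j), gser a v) := by
        rw [Finset.sum_mul_sum]
    _ ≤ (∑' u, gser a u) * (∑' u, gser a u) := by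
        have hs := fun s : Finset ℕ =>
          (gser_summable a).sum_le_tsum s (fun i _ => gser_nonneg a i)
        exact mul_le_mul (hs _) (hs _) (Finset.sum_nonneg fun i _ => gser_nonneg a i)
          (tsum_nonneg (gser_nonneg a))
    _ = _ := (sq _).symm

/-- Placing sensor `σ j` at the centre of cell `j`, the others staying put. -/
noncomputable def place (n m : ℕ) (σ : Fin m ↪ Fin n) (x : Fin n → ℝ) : Fin n → ℝ :=
  Function.extend σ (fun j : Fin m => ((j : ℕ) + 1 / 2 : ℝ) / m) x

theorem place_measurable (n m : ℕ) (σ : Fin m ↪ Fin n) : Measurable (place n m σ) := by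
  rw [measurable_pi_iff]
  intro i
  by_cases h : ∃ j, σ j = i
  · obtain ⟨j, rfl⟩ := h
    simp only [place, σ.injective.extend_apply]
    exact measurable_const
  · simp only [place, Function.extend_apply' _ _ _ h]
    exact measurable_pi_apply i

theorem place_cost (a : ℝ) (ha : 0 < a) (n m : ℕ) (σ : Fin m ↪ Fin n) (x : Fin n → ℝ) :
    ∑ i, |x i - place n m σ x i| ^ a = ∑ j, |x (σ j) - ((j : ℕ) + 1 / 2 : ℝ) / m| ^ a := by
  symm
  apply Fintype.sum_of_injective σ σ.injective
  · intro i hi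
    rw [place, Function.extend_apply' _ _ _ (by simpa using hi)]
    simp [Real.zero_rpow ha.ne']
  · intro j
    rw [place, σ.injective.extend_apply]

theorem place_mem (n m : ℕ) (hm : 0 < m) (σ : Fin m ↪ Fin n) (x : Fin n → ℝ)
    (hx : ∀ i, x i ∈ Set.Icc (0 : ℝ) 1) (i : Fin n) : place n m σ x i ∈ Set.Icc (0 : ℝ) 1 := by
  have hm' : (0 : ℝ) < m := by exact_mod_cast hm
  by_cases h : ∃ j, σ j = i
  · obtain ⟨j, rfl⟩ := h
    rw [place, σ.injective.extend_apply]
    refine ⟨by positivity, ?_⟩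
    rw [div_le_one hm']
    have : ((j : ℕ) : ℝ) + 1 ≤ m := by exact_mod_cast j.2
    linarith
  · rw [place, Function.extend_apply' _ _ _ h]
    exact hx i

theorem place_cover (n m : ℕ) (hm : 0 < m) (σ : Fin m ↪ Fin n) (x : Fin n → ℝ)
    (y : ℝ) (hy : y ∈ Set.Icc (0 : ℝ) 1) : ∃ i, |y - place n m σ x i| ≤ 1 / (2 * m) := by
  have hm' : (0 : ℝ) < m := by exact_mod_cast hm
  have key : ∃ j : ℕ, j < m ∧ (j : ℝ) ≤ m * y ∧ m * y ≤ j + 1 := by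
    have h0 : (0 : ℝ) ≤ m * y := mul_nonneg hm'.le hy.1
    by_cases hlt : ⌊m * y⌋₊ < m
    · exact ⟨_, hlt, Nat.floor_le h0, (Nat.lt_floor_add_one _).le⟩
    · refine ⟨m - 1, by omega, ?_, ?_⟩
      · have h1 : (m : ℝ) ≤ ⌊m * y⌋₊ := by exact_mod_cast not_lt.1 hlt
        have h2 := Nat.floor_le h0
        have h3 : ((m - 1 : ℕ) : ℝ) ≤ m := by exact_mod_cast Nat.sub_le _ _
        linarith
      · have h3 : ((m - 1 : ℕ) : ℝ) + 1 = m := by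
          have : m - 1 + 1 = m := by omega
          exact_mod_cast this
        rw [h3]
        nlinarith [hy.2]
  obtain ⟨j, hj, h1, h2⟩ := key
  refine ⟨σ ⟨j, hj⟩, ?_⟩
  rw [place, σ.injective.extend_apply]
  have e : y - ((j : ℝ) + 1 / 2) / m = (m * y - j - 1 / 2) / m := by field_simp; ring
  have e2 : (1 : ℝ) / (2 * m) = (1 / 2) / m := by field_simp
  simp only
  rw [e, e2, abs_div, abs_of_pos hm']
  gcongr
  rw [abs_le]
  constructor <;> linarith

theorem exists_good (a : ℝ) (ha : 0 < a) (n m : ℕ) (hm : 0 < m) (hmn : m ≤ n) (x : Fin n → ℝ)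
    (hx : ∀ i, x i ∈ Set.Icc (0 : ℝ) 1) :
    ∃ σ : Fin m ↪ Fin n, ∑ i, |x i - place n m σ x i| ^ a ≤
      ∑ j : Fin m, (1 / (m : ℝ)) ^ a * maj a n m j x := by
  have hm' : (0 : ℝ) < m := by exact_mod_cast hm
  choose d hd1 hd2 using fun j : Fin m => exists_d a ha n m j hm x
  obtain ⟨σ, hσ, hσd⟩ := hall_cells n m hmn (fun i => min ⌊m * x i⌋₊ (m - 1))
    (fun i => by have := min_le_right ⌊m * x i⌋₊ (m - 1); omega) d hd1
  refine ⟨⟨σ, hσ⟩, ?_⟩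
  rw [place_cost a ha]
  refine Finset.sum_le_sum fun j _ => ?_
  have h := cell_dist m hm (x (σ j)) (hx _) j (d j) (hσd j).1 (hσd j).2
  calc _ ≤ (((d j : ℝ) + 1) / m) ^ a := Real.rpow_le_rpow (abs_nonneg _) h ha.le
    _ = (1 / (m : ℝ)) ^ a * ((d j : ℝ) + 1) ^ a := by
        rw [← Real.mul_rpow (by positivity) (by positivity)]
        congr 1
        ring
    _ ≤ _ := mul_le_mul_of_nonneg_left (hd2 j) (by positivity)

theorem uniformCube_ae (n : ℕ) : ∀ᵐ x ∂(uniformCube n), ∀ i, x i ∈ Set.Icc (0 : ℝ) 1 := by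
  unfold uniformCube
  rw [← Measure.restrict_pi_pi]
  have := ae_restrict_mem (μ := Measure.pi fun _ : Fin n => (volume : Measure ℝ))
    (MeasurableSet.univ_pi fun _ : Fin n => (measurableSet_Icc : MeasurableSet (Set.Icc (0:ℝ) 1)))
  filter_upwards [this] with x hx i
  exact hx i trivial

/-- Fix real `a > 0`, `p = (9/4)(2+a)`, `x₀ ≥ 3` solving
`x₀/(p ln x₀) = 3`, and a real `f > 6`; set `rₙ = f/(2n)`. Then there is `C > 0` such that
for every `n ≥ ⌈x₀⌉` there is a measurable map `Φₙ : [0,1]ⁿ → [0,1]ⁿ` such that: (i) for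
every input in `[0,1]ⁿ` the output positions cover `[0,1]` with radius `rₙ`; and (ii) for
`n` i.i.d. uniform points `X` on `[0,1]` the expected total displacement to the power `a`
satisfies `𝔼[∑ᵢ |Xᵢ - Φₙ(X)ᵢ|ᵃ] ≤ C · n^{1-a/2} (ln n / n)^{a/2}`. -/
theorem stmt10 (a : ℝ) (ha : 0 < a) (x₀ : ℝ) (hx₀ : 3 ≤ x₀)
    (hx₀eq : x₀ / ((9 / 4 * (2 + a)) * Real.log x₀) = 3)
    (f : ℝ) (hf : 6 < f) :
    ∃ C > 0, ∀ n : ℕ, ⌈x₀⌉₊ ≤ n →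
      ∃ Φ : (Fin n → ℝ) → (Fin n → ℝ), Measurable Φ ∧
        (∀ x : Fin n → ℝ, (∀ i, x i ∈ Set.Icc (0 : ℝ) 1) →
          (∀ i, Φ x i ∈ Set.Icc (0 : ℝ) 1) ∧
          ∀ y ∈ Set.Icc (0 : ℝ) 1, ∃ i, |y - Φ x i| ≤ f / (2 * n)) ∧
        (∫ x, (∑ i, |x i - Φ x i| ^ a) ∂(uniformCube n))
          ≤ C * (1 / (n : ℝ) ^ (a / 2 - 1)) * (Real.log n / n) ^ (a / 2) := by
  have hlog : 1 ≤ Real.log x₀ := by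
    rw [Real.le_log_iff_exp_le (by linarith)]
    have := Real.exp_one_lt_d9
    linarith
  have hx13 : 13 ≤ x₀ := by
    have hp : 0 < 9 / 4 * (2 + a) * Real.log x₀ := by positivity
    rw [div_eq_iff hp.ne'] at hx₀eq
    nlinarith
  set K : ℝ := 1 + (∑' u, gser a u) ^ 2 with hK
  have hKpos : 0 < K := by positivity
  refine ⟨6 ^ a * K, by positivity, ?_⟩
  intro n hn
  have hn' : x₀ ≤ n := (Nat.le_ceil _).trans (by exact_mod_cast hn)
  have hn13r : (13 : ℝ) ≤ n := hx13.trans hn'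
  have hn13 : 13 ≤ n := by exact_mod_cast hn13r
  obtain ⟨m, hm1, hm2⟩ : ∃ m : ℕ, n ≤ 6 * m ∧ 4 * m ≤ n := ⟨(n + 5) / 6, by omega, by omega⟩
  have hm : 0 < m := by omega
  have hm' : (0 : ℝ) < m := by exact_mod_cast hm
  have hm1' : (n : ℝ) ≤ 6 * m := by exact_mod_cast hm1
  have hm2' : 4 * (m : ℝ) ≤ n := by exact_mod_cast hm2
  have hn0 : (0 : ℝ) < n := by linarith
  have : Nonempty (Fin m ↪ Fin n) := ⟨Fin.castLEEmb (by omega)⟩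
  obtain ⟨Φ, hΦ, hΦ2⟩ := exists_measurable_argmin (place n m) (place_measurable n m)
    (fun σ x => ∑ i, |x i - place n m σ x i| ^ a) (by
      intro σ
      have h := measurable_pi_iff.1 (place_measurable n m σ)
      refine Finset.measurable_fun_sum _ fun i _ => ?_
      have h1 : Measurable fun x : Fin n → ℝ => |x i - place n m σ x i| :=
        ((measurable_pi_apply i).sub (h i)).abs
      exact h1.pow_const a)
  refine ⟨Φ, hΦ, ?_, ?_⟩
  · intro x hx
    obtain ⟨σ, hσ, -⟩ := hΦ2 x
    rw [hσ]
    refine ⟨place_mem n m hm σ x hx, ?_⟩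
    intro y hy
    obtain ⟨i, hi⟩ := place_cover n m hm σ x y hy
    refine ⟨i, hi.trans ?_⟩
    rw [div_le_div_iff₀ (by positivity) (by positivity)]
    nlinarith
  · have hIntA : ∫ x, (∑ i, |x i - Φ x i| ^ a) ∂(uniformCube n) ≤
        ∫ x, (∑ j : Fin m, (1 / (m : ℝ)) ^ a * maj a n m j x) ∂(uniformCube n) := by
      apply integral_mono_of_nonneg
      · exact Filter.Eventually.of_forall fun x => Finset.sum_nonneg fun i _ => by positivity
      · exact integrable_finsetSum _ fun j _ => (maj_integrable a n m j).const_mul _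
      · filter_upwards [uniformCube_ae n] with x hx
        obtain ⟨σ, hσ, hmin⟩ := hΦ2 x
        obtain ⟨σ', hσ'⟩ := exists_good a ha n m hm (by omega) x hx
        rw [hσ]
        exact (hmin σ').trans hσ'
    have hIntB : ∫ x, (∑ j : Fin m, (1 / (m : ℝ)) ^ a * maj a n m j x) ∂(uniformCube n) ≤
        m * ((1 / (m : ℝ)) ^ a * K) := by
      rw [integral_finsetSum _ fun (j : Fin m) _ => (maj_integrable a n m j).const_mul _]
      calc _ ≤ ∑ j : Fin m, (1 / (m : ℝ)) ^ a * K := by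
            refine Finset.sum_le_sum fun j _ => ?_
            rw [integral_const_mul]
            exact mul_le_mul_of_nonneg_left (maj_integral a ha n m j hm j.2 hm2) (by positivity)
        _ = _ := by simp
    have h6 : (1 / (m : ℝ)) ^ a ≤ 6 ^ a * (1 / (n : ℝ)) ^ a := by
      rw [← Real.mul_rpow (by positivity) (by positivity)]
      apply Real.rpow_le_rpow (by positivity) _ ha.le
      rw [mul_one_div, div_le_div_iff₀ hm' hn0]
      linarith
    have hlogn : 1 ≤ Real.log n := hlog.trans (Real.log_le_log (by linarith) hn')
    have hr : (n : ℝ) * (1 / (n : ℝ)) ^ a ≤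
        (1 / (n : ℝ) ^ (a / 2 - 1)) * (Real.log n / n) ^ (a / 2) := by
      have e1 : (n : ℝ) * (1 / (n : ℝ)) ^ a =
          (1 / (n : ℝ) ^ (a / 2 - 1)) * (1 / n) ^ (a / 2) := by
        rw [one_div, one_div, Real.inv_rpow hn0.le, Real.inv_rpow hn0.le, ← mul_inv,
          ← Real.rpow_add hn0, show a / 2 - 1 + a / 2 = a - 1 by ring, Real.rpow_sub_one hn0.ne']
        rw [inv_div]
        rfl
      rw [e1]
      gcongr
    calc _ ≤ _ := hIntA
      _ ≤ _ := hIntB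
      _ ≤ n * ((6 ^ a * (1 / (n : ℝ)) ^ a) * K) := by
          gcongr
          linarith
      _ = 6 ^ a * K * (n * (1 / (n : ℝ)) ^ a) := by ring
      _ ≤ 6 ^ a * K * ((1 / (n : ℝ) ^ (a / 2 - 1)) * (Real.log n / n) ^ (a / 2)) := by gcongr
      _ = _ := by ring
end
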